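/- Let i, j ∈ {1, …, n} with j ≠ i, let τ ∈ [−σ_j, σ_j], and let w = e^{−iα_i}(m_j + τ e^{iα_j} − z_i). Let θ_i ∈ (0, π) denote the exterior angle of Ω at the vertex z_i, i.e. the angle between the edge directions e^{iα_{i−1}} and e^{iα_i}. Then Im w ≥ 0 and Im(e^{iθ_i} w) ≥ 0; equivalently, 0 ≤ arg w ≤ π − θ_i whenever w ≠ 0. -/

import Mathlib

open MeasureTheory Complex

/-- The angle `α_i ∈ (-π, π]` that the edge `(z_i, z_{i+1})` makes with the positive real
axis, i.e. `e^{iα_i} = (z_{i+1} - z_i)/|z_{i+1} - z_i|`. -/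
noncomputable def dirAngle {n : ℕ} [NeZero n] (z : Fin n → ℂ) (i : Fin n) : ℝ :=
  (z (i + 1) - z i).arg

/-- Half the length of the edge `(z_i, z_{i+1})`, i.e. `σ_i`. -/
noncomputable def halfLen {n : ℕ} [NeZero n] (z : Fin n → ℂ) (i : Fin n) : ℝ :=
  ‖z (i + 1) - z i‖ / 2

/-- The midpoint `m_i` of the edge `(z_i, z_{i+1})`. -/
noncomputable def midpt {n : ℕ} [NeZero n] (z : Fin n → ℂ) (i : Fin n) : ℂ :=
  (z i + z (i + 1)) / 2

/-- `z : Fin n → ℂ` lists the vertices of a bounded convex polygon in counterclockwise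
order (each vertex an extreme point of the closure): every vertex other than the two
endpoints of a directed edge lies strictly to the left of that edge. -/
def IsCCWConvexPolygon {n : ℕ} [NeZero n] (z : Fin n → ℂ) : Prop :=
  3 ≤ n ∧ ∀ i k : Fin n, k ≠ i → k ≠ i + 1 →
    0 < ((starRingEnd ℂ) (z (i + 1) - z i) * (z k - z i)).im

/-- Rotating an edge by minus its direction angle gives its length. -/
lemma exp_neg_dirAngle_mul_edge {n : ℕ} [NeZero n] (z : Fin n → ℂ) (i : Fin n) :
    exp (-(I * (dirAngle z i : ℝ))) * (z (i + 1) - z i) = (‖z (i + 1) - z i‖ : ℂ) := by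
  have h := norm_mul_exp_arg_mul_I (z (i + 1) - z i)
  calc exp (-(I * (dirAngle z i : ℝ))) * (z (i + 1) - z i)
      = exp (-(I * (dirAngle z i : ℝ))) *
          (‖z (i + 1) - z i‖ * exp ((z (i + 1) - z i).arg * I)) := by rw [h]
    _ = ‖z (i + 1) - z i‖ *
          (exp (-(I * (dirAngle z i : ℝ))) * exp ((z (i + 1) - z i).arg * I)) := by ring
    _ = (‖z (i + 1) - z i‖ : ℂ) := by
      rw [← exp_add, dirAngle, mul_comm I, neg_add_cancel, exp_zero, mul_one]

/-- The norm of an edge times its reversed direction is the conjugate of the edge. -/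
lemma norm_mul_exp_neg_dirAngle {n : ℕ} [NeZero n] (z : Fin n → ℂ) (i : Fin n) :
    (‖z (i + 1) - z i‖ : ℂ) * exp (-(I * (dirAngle z i : ℝ))) =
      (starRingEnd ℂ) (z (i + 1) - z i) := by
  have h := congrArg (starRingEnd ℂ) (norm_mul_exp_arg_mul_I (z (i + 1) - z i))
  rw [← h, map_mul, ← exp_conj, map_mul, conj_ofReal, conj_ofReal, conj_I, dirAngle]
  congr 2
  ring

/-- Every vertex of a convex polygon lies weakly to the left of every directed edge. -/
lemma IsCCWConvexPolygon.im_vertex_nonneg {n : ℕ} [NeZero n] {z : Fin n → ℂ}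
    (hz : IsCCWConvexPolygon z) (i k : Fin n) :
    0 ≤ (exp (-(I * (dirAngle z i : ℝ))) * (z k - z i)).im := by
  by_cases hki : k = i
  · simp [hki]
  by_cases hki' : k = i + 1
  · rw [hki', exp_neg_dirAngle_mul_edge, ofReal_im]
  have h := hz.2 i k hki hki'
  rw [← norm_mul_exp_neg_dirAngle, mul_assoc, im_ofReal_mul] at h
  exact (pos_of_mul_pos_right h (norm_nonneg _)).le

/-- The point at signed distance `τ` from the midpoint of an edge is a convex combination of
the endpoints of the edge. -/
lemma exists_convex_comb_of_mem_edge {n : ℕ} [NeZero n] (z : Fin n → ℂ) (j : Fin n) {τ : ℝ}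
    (hτ : τ ∈ Set.Icc (-(halfLen z j)) (halfLen z j)) :
    ∃ t ∈ Set.Icc (0 : ℝ) 1,
      midpt z j + (τ : ℂ) * exp (I * (dirAngle z j : ℝ)) =
        ((1 - t : ℝ) : ℂ) * z j + (t : ℂ) * z (j + 1) := by
  have h := norm_mul_exp_arg_mul_I (z (j + 1) - z j)
  rw [mul_comm _ I] at h
  obtain ⟨h₁, h₂⟩ := hτ
  unfold halfLen at h₁ h₂
  unfold midpt dirAngle
  rcases (norm_nonneg (z (j + 1) - z j)).eq_or_lt with h₀ | h₀
  · have hτ₀ : τ = 0 := by linarith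
    refine ⟨1 / 2, by norm_num, ?_⟩
    rw [hτ₀]
    push_cast
    ring
  · refine ⟨1 / 2 + τ / ‖z (j + 1) - z j‖, ⟨?_, ?_⟩, ?_⟩
    · have : -(1 / 2) ≤ τ / ‖z (j + 1) - z j‖ := by
        rw [le_div_iff₀ h₀]
        linarith
      linarith
    · have : τ / ‖z (j + 1) - z j‖ ≤ 1 / 2 := by
        rw [div_le_iff₀ h₀]
        linarith
      linarith
    · have hne : (‖z (j + 1) - z j‖ : ℂ) ≠ 0 := ofReal_ne_zero.mpr h₀.ne'
      have hexp : (τ : ℂ) * exp (I * (z (j + 1) - z j).arg) =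
          τ / ‖z (j + 1) - z j‖ * (z (j + 1) - z j) := by
        rw [div_mul_eq_mul_div, eq_div_iff hne]
        linear_combination (τ : ℂ) * h
      rw [hexp]
      push_cast
      ring

/-- Every boundary point of a convex polygon lies weakly to the left of every directed edge. -/
lemma IsCCWConvexPolygon.im_edge_point_nonneg {n : ℕ} [NeZero n] {z : Fin n → ℂ}
    (hz : IsCCWConvexPolygon z) (i j : Fin n) {τ : ℝ}
    (hτ : τ ∈ Set.Icc (-(halfLen z j)) (halfLen z j)) :
    0 ≤ (exp (-(I * (dirAngle z i : ℝ))) *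
      (midpt z j + (τ : ℂ) * exp (I * (dirAngle z j : ℝ)) - z i)).im := by
  obtain ⟨t, ⟨ht₀, ht₁⟩, ht⟩ := exists_convex_comb_of_mem_edge z j hτ
  have hcomb : exp (-(I * (dirAngle z i : ℝ))) *
      (((1 - t : ℝ) : ℂ) * z j + (t : ℂ) * z (j + 1) - z i) =
      ((1 - t : ℝ) : ℂ) * (exp (-(I * (dirAngle z i : ℝ))) * (z j - z i)) +
        (t : ℂ) * (exp (-(I * (dirAngle z i : ℝ))) * (z (j + 1) - z i)) := by
    push_cast
    ring
  rw [ht, hcomb, add_im, im_ofReal_mul, im_ofReal_mul]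
  exact add_nonneg (mul_nonneg (sub_nonneg.mpr ht₁) (hz.im_vertex_nonneg i j))
    (mul_nonneg ht₀ (hz.im_vertex_nonneg i (j + 1)))

/-- For `j ≠ i`, `τ ∈ [-σ_j, σ_j]` and
`w = e^{-iα_i}(m_j + τ e^{iα_j} - z_i)`, if `θ_i ∈ (0, π)` is the exterior angle at the
vertex `z_i` (so that `e^{iθ_i} e^{iα_{i-1}} = e^{iα_i}`), then `Im w ≥ 0` and
`Im (e^{iθ_i} w) ≥ 0`; equivalently `0 ≤ arg w ≤ π - θ_i` whenever `w ≠ 0`. -/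
theorem stmt7 {n : ℕ} [NeZero n] (z : Fin n → ℂ) (hz : IsCCWConvexPolygon z)
    (i j : Fin n) (hji : j ≠ i) (θ : ℝ) (hθ : θ ∈ Set.Ioo 0 Real.pi)
    (hθeq : Complex.exp (Complex.I * (θ : ℝ)) *
        Complex.exp (Complex.I * (dirAngle z (i - 1) : ℝ)) =
      Complex.exp (Complex.I * (dirAngle z i : ℝ)))
    (τ : ℝ) (hτ : τ ∈ Set.Icc (-(halfLen z j)) (halfLen z j)) :
    0 ≤ (Complex.exp (-(Complex.I * (dirAngle z i : ℝ))) *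
        (midpt z j + (τ : ℂ) * Complex.exp (Complex.I * (dirAngle z j : ℝ)) - z i)).im ∧
    0 ≤ (Complex.exp (Complex.I * (θ : ℝ)) *
        (Complex.exp (-(Complex.I * (dirAngle z i : ℝ))) *
          (midpt z j + (τ : ℂ) * Complex.exp (Complex.I * (dirAngle z j : ℝ)) - z i))).im := by
  refine ⟨hz.im_edge_point_nonneg i j hτ, ?_⟩
  have hrot : exp (I * (θ : ℝ)) * exp (-(I * (dirAngle z i : ℝ))) =
      exp (-(I * (dirAngle z (i - 1) : ℝ))) := by
    rw [exp_neg, exp_neg, ← hθeq]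
    field_simp [exp_ne_zero]
  have hedge := exp_neg_dirAngle_mul_edge z (i - 1)
  rw [sub_add_cancel] at hedge
  have h := hz.im_edge_point_nonneg (i - 1) j hτ
  rw [← sub_add_sub_cancel _ (z i), mul_add, hedge, add_im, ofReal_im, add_zero] at h
  rwa [← mul_assoc, hrot]
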